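/- For u, z ∈ ℍⁿ with |u| < 1, |z| < 1, the real Jacobian determinant of Φ_u at z (as a map ℝ^{4n} → ℝ^{4n}) has absolute value (1−|u|²)^{2n+2} / |1 − ⟨z,u⟩|^{4n+4}. Equivalently, |det D_ℝ Φ_u(z)| = ((1−|Φ_u(z)|²)/(1−|z|²))^{2n+2}. -/

import Mathlib

noncomputable section

abbrev ℍ := Quaternion ℝ

def qinner {n : ℕ} (z w : Fin n → ℍ) : ℍ := ∑ i, star (w i) * z i

def qnormSq {n : ℕ} (u : Fin n → ℍ) : ℝ := ∑ i, ‖u i‖ ^ 2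

def qnorm {n : ℕ} (u : Fin n → ℍ) : ℝ := Real.sqrt (qnormSq u)

def Au {n : ℕ} (u : Fin n → ℍ) (x : Fin n → ℍ) : Fin n → ℍ :=
  fun i => ((1 + Real.sqrt (1 - qnormSq u))⁻¹) • (u i * qinner x u)
    + (Real.sqrt (1 - qnormSq u)) • x i

/-- The quaternionic Hua map Φ_u(z) = (u − A_u z)(1 − ⟨z,u⟩)⁻¹. -/
def Phiu {n : ℕ} (u : Fin n → ℍ) (z : Fin n → ℍ) : Fin n → ℍ :=
  fun i => (u i - Au u z i) * (1 - qinner z u)⁻¹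

lemma qsq (a : ℍ) : ‖a‖ ^ 2 = a.re^2 + a.imI^2 + a.imJ^2 + a.imK^2 := by
  rw [sq, ← Quaternion.normSq_eq_norm_mul_self, Quaternion.normSq_def']

def qmk (v : Fin 4 → ℝ) : ℍ := ⟨v 0, v 1, v 2, v 3⟩

lemma qmk_re (v : Fin 4 → ℝ) : (qmk v).re = v 0 := rfl
lemma qmk_imI (v : Fin 4 → ℝ) : (qmk v).imI = v 1 := rfl
lemma qmk_imJ (v : Fin 4 → ℝ) : (qmk v).imJ = v 2 := rfl
lemma qmk_imK (v : Fin 4 → ℝ) : (qmk v).imK = v 3 := rfl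

def qBEquiv : ℍ ≃ₗ[ℝ] (Fin 4 → ℝ) where
  toFun a := ![a.re, a.imI, a.imJ, a.imK]
  invFun := qmk
  left_inv a := rfl
  right_inv v := by funext i; fin_cases i <;> rfl
  map_add' x y := by funext i; fin_cases i <;> simp
  map_smul' r x := by funext i; fin_cases i <;> simp

def qB : Module.Basis (Fin 4) ℝ ℍ := Module.Basis.ofEquivFun qBEquiv

lemma qB_repr (a : ℍ) (i : Fin 4) : qB.repr a i = (![a.re, a.imI, a.imJ, a.imK] : Fin 4 → ℝ) i := rfl

lemma qB_apply (i : Fin 4) : qB i = qmk (Pi.single i 1) := by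
  simp only [qB, Module.Basis.coe_ofEquivFun]
  rfl

lemma det_left (a : ℍ) : LinearMap.det (LinearMap.mulLeft ℝ a) = ‖a‖ ^ 4 := by
  have : LinearMap.toMatrix qB qB (LinearMap.mulLeft ℝ a) =
      !![a.re, -a.imI, -a.imJ, -a.imK; a.imI, a.re, -a.imK, a.imJ;
         a.imJ, a.imK, a.re, -a.imI; a.imK, -a.imJ, a.imI, a.re] := by
    ext i j
    rw [LinearMap.toMatrix_apply, qB_repr, qB_apply]
    fin_cases i <;> fin_cases j <;> simp [qmk_re, qmk_imI, qmk_imJ, qmk_imK]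
  rw [← LinearMap.det_toMatrix qB, this, show ‖a‖^4 = (‖a‖^2)^2 by ring, qsq]
  simp [Matrix.det_succ_row_zero, Fin.sum_univ_succ, Fin.succAbove]
  ring

lemma det_right (a : ℍ) : LinearMap.det (LinearMap.mulRight ℝ a) = ‖a‖ ^ 4 := by
  have : LinearMap.toMatrix qB qB (LinearMap.mulRight ℝ a) =
      !![a.re, -a.imI, -a.imJ, -a.imK; a.imI, a.re, a.imK, -a.imJ;
         a.imJ, -a.imK, a.re, a.imI; a.imK, a.imJ, -a.imI, a.re] := by
    ext i j
    rw [LinearMap.toMatrix_apply, qB_repr, qB_apply]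
    fin_cases i <;> fin_cases j <;> simp [qmk_re, qmk_imI, qmk_imJ, qmk_imK]
  rw [← LinearMap.det_toMatrix qB, this, show ‖a‖^4 = (‖a‖^2)^2 by ring, qsq]
  simp [Matrix.det_succ_row_zero, Fin.sum_univ_succ, Fin.succAbove]
  ring

lemma det_id_sub_comm {M N : Type*} [AddCommGroup M] [Module ℝ M] [Module.Finite ℝ M]
    [AddCommGroup N] [Module ℝ N] [Module.Finite ℝ N] (f : N →ₗ[ℝ] M) (g : M →ₗ[ℝ] N) :
    LinearMap.det (LinearMap.id - f ∘ₗ g) = LinearMap.det (LinearMap.id - g ∘ₗ f) := by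
  classical
  let b := Module.finBasis ℝ M
  let c := Module.finBasis ℝ N
  rw [← LinearMap.det_toMatrix b, ← LinearMap.det_toMatrix c, map_sub, map_sub,
    LinearMap.toMatrix_id, LinearMap.toMatrix_id, LinearMap.toMatrix_comp b c b,
    LinearMap.toMatrix_comp c b c, Matrix.det_one_sub_mul_comm]

lemma qinner_add {n : ℕ} (x y u : Fin n → ℍ) : qinner (x + y) u = qinner x u + qinner y u := by
  simp [qinner, mul_add, Finset.sum_add_distrib]

lemma qinner_smul {n : ℕ} (r : ℝ) (x u : Fin n → ℍ) : qinner (r • x) u = r • qinner x u := by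
  simp [qinner, Finset.smul_sum]

lemma qinner_mulr {n : ℕ} (x u : Fin n → ℍ) (c : ℍ) :
    qinner (fun i => x i * c) u = qinner x u * c := by
  simp [qinner, Finset.sum_mul, mul_assoc]

lemma qinner_sub {n : ℕ} (x y u : Fin n → ℍ) : qinner (x - y) u = qinner x u - qinner y u := by
  simp [qinner, mul_sub]

lemma qinner_self {n : ℕ} (u : Fin n → ℍ) : qinner u u = ((qnormSq u : ℝ) : ℍ) := by
  have h : ∀ i, star (u i) * u i = ((‖u i‖ ^ 2 : ℝ) : ℍ) := fun i => by
    rw [Quaternion.star_mul_self, Quaternion.normSq_eq_norm_mul_self, sq]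
  simp only [qinner, qnormSq, h]
  exact (map_sum (algebraMap ℝ ℍ) _ _).symm

lemma qinner_Au {n : ℕ} (u x : Fin n → ℍ) (hu : qnormSq u ≤ 1) :
    qinner (Au u x) u = qinner x u := by
  have hs := Real.sq_sqrt (sub_nonneg.2 hu)
  have hs0 := Real.sqrt_nonneg (1 - qnormSq u)
  set s := Real.sqrt (1 - qnormSq u) with hsdef
  have h1 : Au u x = (1 + s)⁻¹ • (fun i => u i * qinner x u) + s • x := by
    funext i; simp [Au, hsdef]
  have h2 : qnormSq u = (1 - s) * (1 + s) := by linarith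
  rw [h1, qinner_add, qinner_smul, qinner_smul, qinner_mulr, qinner_self, h2,
    Quaternion.coe_mul_eq_smul, smul_smul, ← add_smul]
  have : (1 + s)⁻¹ * ((1 - s) * (1 + s)) + s = 1 := by
    have : 1 + s ≠ 0 := by linarith
    field_simp; ring
  rw [this, one_smul]

lemma qnormSq_mulr {n : ℕ} (x : Fin n → ℍ) (c : ℍ) :
    qnormSq (fun i => x i * c) = qnormSq x * ‖c‖ ^ 2 := by
  simp [qnormSq, Finset.sum_mul, mul_pow]

lemma qnormSq_smul {n : ℕ} (x : Fin n → ℍ) (c : ℝ) :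
    qnormSq (c • x) = c ^ 2 * qnormSq x := by
  simp [qnormSq, Finset.mul_sum, mul_pow, norm_smul]

lemma qnormSq_add {n : ℕ} (x y : Fin n → ℍ) :
    qnormSq (x + y) = qnormSq x + 2 * (qinner x y).re + qnormSq y := by
  have h : (qinner x y).re = ∑ i, (star (y i) * x i).re := by
    exact map_sum (QuaternionAlgebra.reₗ (-1:ℝ) 0 (-1)) _ _
  rw [h, qnormSq, qnormSq, qnormSq, Finset.mul_sum, ← Finset.sum_add_distrib,
    ← Finset.sum_add_distrib]
  refine Finset.sum_congr rfl fun i _ => ?_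
  simp only [qsq]
  simp
  ring

lemma qinner_star {n : ℕ} (x y : Fin n → ℍ) : qinner x y = star (qinner y x) := by
  simp [qinner]

lemma key {n : ℕ} (u z : Fin n → ℍ) (hu : qnormSq u ≤ 1) :
    ‖1 - qinner z u‖ ^ 2 = qnormSq (u - Au u z) + (1 - qnormSq u) * (1 - qnormSq z) := by
  have hs := Real.sq_sqrt (sub_nonneg.2 hu)
  have hs0 := Real.sqrt_nonneg (1 - qnormSq u)
  have hA := qinner_Au u z hu
  set s := Real.sqrt (1 - qnormSq u) with hsdef
  have h1 : Au u z = (1 + s)⁻¹ • (fun i => u i * qinner z u) + s • z := by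
    funext i; simp [Au, hsdef]
  have h2 : qnormSq u = (1 - s) * (1 + s) := by linarith
  have h3 : qnormSq (Au u z) = ‖qinner z u‖ ^ 2 + s ^ 2 * qnormSq z := by
    have e : (qinner (fun i => u i * qinner z u) z).re = ‖qinner z u‖ ^ 2 := by
      rw [qinner_mulr, qinner_star u z, Quaternion.star_mul_self,
        Quaternion.normSq_eq_norm_mul_self, sq]
      simp
    have e2 : (qinner ((1 + s)⁻¹ • (fun i => u i * qinner z u)) (s • z)).re
        = (1 + s)⁻¹ * s * ‖qinner z u‖ ^ 2 := by
      have e3 : qinner (fun i => u i * qinner z u) (s • z)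
          = s • qinner (fun i => u i * qinner z u) z := by
        simp [qinner, Finset.smul_sum]
      rw [qinner_smul, e3, Quaternion.re_smul, Quaternion.re_smul, e]
      simp [mul_assoc]
    rw [h1, qnormSq_add, e2, qnormSq_smul, qnormSq_smul, qnormSq_mulr, h2]
    have : 1 + s ≠ 0 := by linarith
    field_simp; ring
  have h4 : qnormSq (u - Au u z) = qnormSq u - 2 * (qinner z u).re + qnormSq (Au u z) := by
    have : u - Au u z = (-1 : ℝ) • Au u z + u := by
      rw [neg_one_smul]; abel
    rw [this, qnormSq_add, qnormSq_smul, qinner_smul, hA]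
    simp; ring
  rw [h4, h3, h2]
  simp only [qsq, Quaternion.re_sub, Quaternion.imI_sub, Quaternion.imJ_sub, Quaternion.imK_sub,
    Quaternion.re_one, Quaternion.imI_one, Quaternion.imJ_one, Quaternion.imK_one]
  ring

lemma alg1 (s N : ℝ) (hs : s ≠ 0) (h1 : 1 + s ≠ 0) (hN : s ^ 2 = 1 - N) (q : ℍ) :
    1 - s⁻¹ • ((1 - (1 - N) • q) - (1 + s)⁻¹ • (N • (1 : ℍ))) = s • q := by
  obtain rfl : N = 1 - s ^ 2 := by linarith
  match_scalars <;> field_simp <;> ring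

lemma alg2 (s t : ℝ) (hs : s ≠ 0) (a p v c h r : ℍ) (hp : a * r = p) :
    a * (r * c * r) + (-(t • (v * c) + s • h)) * r =
      ((-s) • (h - (s⁻¹ • (p - t • v)) * c)) * r := by
  have : a * (r * c * r) = (p * c) * r := by rw [← hp]; simp only [mul_assoc]
  rw [this, ← add_mul]
  congr 1
  rw [smul_mul_assoc, sub_mul, smul_mul_assoc]
  match_scalars <;> field_simp

def qinnerL {n : ℕ} (u : Fin n → ℍ) : (Fin n → ℍ) →ₗ[ℝ] ℍ where
  toFun x := qinner x u
  map_add' x y := qinner_add x y u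
  map_smul' r x := qinner_smul r x u

def outerL {n : ℕ} (w : Fin n → ℍ) : ℍ →ₗ[ℝ] (Fin n → ℍ) where
  toFun c i := w i * c
  map_add' x y := by funext i; simp [mul_add]
  map_smul' r x := by funext i; simp

def mulrL (n : ℕ) (c : ℍ) : (Fin n → ℍ) →ₗ[ℝ] (Fin n → ℍ) :=
  LinearMap.pi (fun i ↦ (LinearMap.mulRight ℝ c).comp (LinearMap.proj i))

lemma det_mulrL (n : ℕ) (c : ℍ) : LinearMap.det (mulrL n c) = ‖c‖ ^ (4 * n) := by
  rw [mulrL, LinearMap.det_pi]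
  simp [det_right, pow_mul]

lemma det_rank {n : ℕ} (u w : Fin n → ℍ) :
    LinearMap.det (LinearMap.id - outerL w ∘ₗ qinnerL u) = ‖1 - qinner w u‖ ^ 4 := by
  rw [det_id_sub_comm, ← det_left]
  congr 1
  ext1 x
  simp [outerL, qinnerL, qinner_mulr, sub_mul]

lemma fderiv_Phiu {n : ℕ} (u z : Fin n → ℍ) (hq : 1 - qinner z u ≠ 0)
    (hs : Real.sqrt (1 - qnormSq u) ≠ 0) :
    (fderiv ℝ (Phiu u) z : (Fin n → ℍ) →ₗ[ℝ] (Fin n → ℍ)) =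
      mulrL n (1 - qinner z u)⁻¹ ∘ₗ ((-Real.sqrt (1 - qnormSq u)) •
        (LinearMap.id - outerL ((Real.sqrt (1 - qnormSq u))⁻¹ •
          (Phiu u z - (1 + Real.sqrt (1 - qnormSq u))⁻¹ • u)) ∘ₗ qinnerL u)) := by
  set s := Real.sqrt (1 - qnormSq u) with hsdef
  set q := 1 - qinner z u with hqdef
  let I : (Fin n → ℍ) →L[ℝ] ℍ := LinearMap.toContinuousLinearMap (qinnerL u)
  have hI : HasFDerivAt (fun z => qinner z u) I z := I.hasFDerivAt
  have hinv : HasFDerivAt (𝕜 := ℝ) (fun z => (1 - qinner z u)⁻¹) _ z :=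
    (hasFDerivAt_inv' (𝕜 := ℝ) hq).comp z (hI.const_sub 1)
  set L : (Fin n → ℍ) →ₗ[ℝ] (Fin n → ℍ) := mulrL n q⁻¹ ∘ₗ ((-s) •
        (LinearMap.id - outerL (s⁻¹ • (Phiu u z - (1 + s)⁻¹ • u)) ∘ₗ qinnerL u)) with hL
  have hΦ : HasFDerivAt (𝕜 := ℝ) (Phiu u) (LinearMap.toContinuousLinearMap L) z := by
    refine hasFDerivAt_pi'.2 fun i => ?_
    have hp : HasFDerivAt (𝕜 := ℝ) (fun z : Fin n → ℍ => z i)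
        (ContinuousLinearMap.proj (R := ℝ) (φ := fun _ : Fin n => ℍ) i) z :=
      (ContinuousLinearMap.proj (R := ℝ) (φ := fun _ : Fin n => ℍ) i).hasFDerivAt
    have hh := ((((hI.const_mul (u i)).const_smul ((1 + s)⁻¹)).add
      (hp.const_smul s)).const_sub (u i)).mul' hinv
    refine HasFDerivAt.congr_fderiv hh ?_
    ext1 h
    have e1 : (u i - Au u z i) * q⁻¹ = Phiu u z i := rfl
    have e3 : I h = qinner h u := rfl
    have e4 : (qinnerL u) h = qinner h u := rfl
    have e5 : (LinearMap.toContinuousLinearMap L h) i = ((-s) • (h i - (s⁻¹ • (Phiu u z i - (1 + s)⁻¹ • u i)) * qinner h u)) * q⁻¹ := rfl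
    have e6 := alg2 s (1 + s)⁻¹ hs (u i - Au u z i) (Phiu u z i) (u i) (qinner h u) (h i) q⁻¹ e1
    change _ = (LinearMap.toContinuousLinearMap L h) i
    rw [e5, ← e6]
    have e7 : u i - ((1 + s)⁻¹ • (u i * qinner z u) + s • z i) = u i - Au u z i := rfl
    simp [e7, e3, ← hqdef, add_mul]
  rw [hΦ.fderiv]
  rfl

/-- The absolute value of the real Jacobian determinant of Φ_u at z,
viewing ℍⁿ as ℝ^{4n}, is (1−|u|²)^{2n+2}/|1−⟨z,u⟩|^{4n+4}
= ((1−|Φ_u(z)|²)/(1−|z|²))^{2n+2}. -/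
theorem jacobian_Phiu {n : ℕ} (u z : Fin n → ℍ) (hu : qnorm u < 1) (hz : qnorm z < 1) :
    |LinearMap.det (fderiv ℝ (Phiu u) z : (Fin n → ℍ) →ₗ[ℝ] (Fin n → ℍ))|
        = (1 - qnormSq u) ^ (2 * n + 2) / ‖1 - qinner z u‖ ^ (4 * n + 4) ∧
    |LinearMap.det (fderiv ℝ (Phiu u) z : (Fin n → ℍ) →ₗ[ℝ] (Fin n → ℍ))|
        = ((1 - qnormSq (Phiu u z)) / (1 - qnormSq z)) ^ (2 * n + 2) := by
  have hu1 : qnormSq u < 1 := by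
    have := (Real.sqrt_lt' one_pos).1 hu; simpa using this
  have hz1 : qnormSq z < 1 := by
    have := (Real.sqrt_lt' one_pos).1 hz; simpa using this
  have hk := key u z hu1.le
  have hN : 0 ≤ qnormSq (u - Au u z) := Finset.sum_nonneg fun i _ => by positivity
  have hpos : 0 < ‖1 - qinner z u‖ ^ 2 := by
    have := mul_pos (sub_pos.2 hu1) (sub_pos.2 hz1)
    linarith
  have hq : 1 - qinner z u ≠ 0 := by
    intro h; rw [h] at hpos; simp at hpos
  have hq0 : ‖1 - qinner z u‖ ≠ 0 := norm_ne_zero_iff.2 hq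
  have hΦ : qnormSq (Phiu u z) = qnormSq (u - Au u z) * (‖1 - qinner z u‖⁻¹) ^ 2 := by
    rw [← norm_inv, ← qnormSq_mulr]; rfl
  have hs0 : 0 < Real.sqrt (1 - qnormSq u) := Real.sqrt_pos.2 (sub_pos.2 hu1)
  have hs := Real.sq_sqrt (sub_pos.2 hu1).le
  have hip : 1 - qinner (Phiu u z) u = (1 - qnormSq u) • (1 - qinner z u)⁻¹ := by
    have : qinner (Phiu u z) u = qinner (u - Au u z) u * (1 - qinner z u)⁻¹ := by
      rw [← qinner_mulr]; rfl
    rw [this, qinner_sub, qinner_Au u z hu1.le, qinner_self,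
      ← Quaternion.coe_mul_eq_smul, Quaternion.coe_sub, Quaternion.coe_one]
    nth_rw 1 [← mul_inv_cancel₀ hq]
    rw [← sub_mul]
    congr 1
    abel
  have hfirst : |LinearMap.det (fderiv ℝ (Phiu u) z : (Fin n → ℍ) →ₗ[ℝ] (Fin n → ℍ))|
        = (1 - qnormSq u) ^ (2 * n + 2) / ‖1 - qinner z u‖ ^ (4 * n + 4) := by
    rw [fderiv_Phiu u z hq hs0.ne', LinearMap.det_comp, LinearMap.det_smul, det_mulrL, det_rank]
    have hw : 1 - qinner ((Real.sqrt (1 - qnormSq u))⁻¹ •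
          (Phiu u z - (1 + Real.sqrt (1 - qnormSq u))⁻¹ • u)) u
          = Real.sqrt (1 - qnormSq u) • (1 - qinner z u)⁻¹ := by
      rw [qinner_smul, qinner_sub, qinner_smul, qinner_self]
      have h3 : qinner (Phiu u z) u = 1 - (1 - qnormSq u) • (1 - qinner z u)⁻¹ := by
        rw [← hip]; abel
      rw [h3, show ((qnormSq u : ℝ) : ℍ) = qnormSq u • (1 : ℍ) from by
        rw [← Quaternion.coe_mul_eq_smul, mul_one]]
      exact alg1 _ _ hs0.ne' (by positivity) hs _
    rw [hw, norm_smul, show (1 - qnormSq u) ^ (2 * n + 2)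
      = Real.sqrt (1 - qnormSq u) ^ (4 * n + 4) by
        nth_rw 1 [← hs]; rw [← pow_mul]; congr 1; ring]
    have hfr : Module.finrank ℝ (Fin n → ℍ) = 4 * n := by
      rw [Module.finrank_pi_fintype]
      simp [Quaternion.finrank_eq_four, mul_comm]
    rw [hfr, norm_inv, abs_mul, abs_mul, abs_pow, abs_pow, abs_pow, abs_neg, abs_of_pos hs0,
      Real.norm_of_nonneg hs0.le]
    simp only [abs_mul, abs_inv, abs_norm, abs_of_pos hs0, inv_pow, mul_pow]
    field_simp
    ring
  refine ⟨hfirst, ?_⟩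
  rw [hfirst]
  have : (1 - qnormSq (Phiu u z)) / (1 - qnormSq z) = (1 - qnormSq u) / ‖1 - qinner z u‖ ^ 2 := by
    rw [hΦ]
    have : 1 - qnormSq z ≠ 0 := (sub_pos.2 hz1).ne'
    field_simp
    linarith
  rw [this, div_pow, ← pow_mul]
  congr 2
  ring
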